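/- Let a(n) be the number of Dyck paths of semi-length n with no peak of odd height at least 3, and let f = \sum_{n\ge 0} a(n) x^n in the ring of formal power series over the integers. Then f = 1 + x f + x^2 f^2. -/

import Mathlib

open Finset PowerSeries

/-- A word over the step alphabet (`true` = U = (1,1), `false` = D = (1,-1)) is a
Dyck path if it has equally many U's and D's and every prefix has at least as
many U's as D's (i.e. the lattice path never goes below the x-axis). -/
def IsDyck (w : List Bool) : Prop :=
  w.count true = w.count false ∧
    ∀ k, (w.take k).count false ≤ (w.take k).count true
/-- The height (y-coordinate) of the lattice point reached after the first `k` steps. -/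
def ht (w : List Bool) (k : ℕ) : ℕ :=
  (w.take k).count true - (w.take k).count false
/-- The word `w` has a peak (an occurrence of the factor `UD`) at position `i`;
the height of this peak is `ht w (i+1)`. -/
def IsPeakAt (w : List Bool) (i : ℕ) : Prop :=
  w[i]? = some true ∧ w[i + 1]? = some false

open BinaryTree

/-- No peak of `w` has odd height at least `3` when the path `w` starts at height `h`. -/
def NoOddPeaksFrom (h : ℤ) (w : List Bool) : Prop :=
  ∀ i, IsPeakAt w i →
    ¬ (Odd (h + (w.take (i + 1)).count true - (w.take (i + 1)).count false) ∧
      3 ≤ h + (w.take (i + 1)).count true - (w.take (i + 1)).count false)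

lemma noOddPeaksFrom_nil (h : ℤ) : NoOddPeaksFrom h [] := by
  intro i hi
  simp [IsPeakAt] at hi

lemma noOddPeaksFrom_false_cons (h : ℤ) (w : List Bool) :
    NoOddPeaksFrom h (false :: w) ↔ NoOddPeaksFrom (h - 1) w := by
  have key (i : ℕ) : h + ((false :: w).take (i + 1 + 1)).count true -
      ((false :: w).take (i + 1 + 1)).count false =
        h - 1 + (w.take (i + 1)).count true - (w.take (i + 1)).count false := by
    simp [List.take_succ_cons]
    ring
  constructor
  · intro H i hi
    rw [← key]
    exact H (i + 1) (by simpa [IsPeakAt] using hi)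
  · rintro H (_ | i) hi
    · simp [IsPeakAt] at hi
    · rw [key]
      exact H i (by simpa [IsPeakAt] using hi)

lemma noOddPeaksFrom_true_cons (h : ℤ) (w : List Bool) :
    NoOddPeaksFrom h (true :: w) ↔
      (w[0]? = some false → ¬ (Odd (h + 1) ∧ 3 ≤ h + 1)) ∧ NoOddPeaksFrom (h + 1) w := by
  have key (i : ℕ) : h + ((true :: w).take (i + 1 + 1)).count true -
      ((true :: w).take (i + 1 + 1)).count false =
        h + 1 + (w.take (i + 1)).count true - (w.take (i + 1)).count false := by
    simp [List.take_succ_cons]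
    ring
  constructor
  · intro H
    refine ⟨fun hw => ?_, fun i hi => ?_⟩
    · simpa using H 0 (by simpa [IsPeakAt] using hw)
    · rw [← key]
      exact H (i + 1) (by simpa [IsPeakAt] using hi)
  · rintro ⟨H₀, H⟩ (_ | i) hi
    · simpa using H₀ (by simpa [IsPeakAt] using hi)
    · rw [key]
      exact H i (by simpa [IsPeakAt] using hi)

/-- The word of up and down steps encoded by a binary tree: a node with subtrees `l` and `r`
becomes `U l D r`. -/
def treeWord : BinaryTree Unit → List Bool
  | .nil => []
  | .node _ l r => true :: (treeWord l ++ false :: treeWord r)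

/-- The tree counterpart of `NoOddPeaksFrom`. -/
def TreeNoOddPeaksFrom (h : ℤ) : BinaryTree Unit → Prop
  | .nil => True
  | .node _ l r => ((l = .nil → ¬ (Odd (h + 1) ∧ 3 ≤ h + 1)) ∧ TreeNoOddPeaksFrom (h + 1) l) ∧
      TreeNoOddPeaksFrom h r

lemma noOddPeaksFrom_treeWord_append (t : BinaryTree Unit) (h : ℤ) (w : List Bool) :
    NoOddPeaksFrom h (treeWord t ++ w) ↔ TreeNoOddPeaksFrom h t ∧ NoOddPeaksFrom h w := by
  induction t generalizing h w with
  | nil => simp [treeWord, TreeNoOddPeaksFrom]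
  | node _ l r ihl ihr =>
    have hl : (treeWord l ++ false :: (treeWord r ++ w))[0]? = some false ↔ l = .nil := by
      cases l <;> simp [treeWord]
    simp only [treeWord, TreeNoOddPeaksFrom, List.cons_append, List.append_assoc,
      noOddPeaksFrom_true_cons, noOddPeaksFrom_false_cons, ihl, ihr, hl, add_sub_cancel_right]
    tauto

lemma noOddPeaksFrom_treeWord (t : BinaryTree Unit) (h : ℤ) :
    NoOddPeaksFrom h (treeWord t) ↔ TreeNoOddPeaksFrom h t := by
  simpa [noOddPeaksFrom_nil] using noOddPeaksFrom_treeWord_append t h []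

lemma noOddPeaksFrom_zero_iff {w : List Bool} (hw : IsDyck w) :
    NoOddPeaksFrom 0 w ↔
      ∀ i, IsPeakAt w i → ¬ (Odd (ht w (i + 1)) ∧ 3 ≤ ht w (i + 1)) := by
  refine forall₂_congr fun i _ => ?_
  have hk : (0 : ℤ) + (w.take (i + 1)).count true - (w.take (i + 1)).count false =
      (ht w (i + 1) : ℕ) := by
    have := hw.2 (i + 1)
    unfold ht
    omega
  rw [hk, Int.odd_coe_nat]
  norm_cast

/-- Up and down steps as Booleans. -/
def dyckStepEquivBool : DyckStep ≃ Bool where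
  toFun | .U => true | .D => false
  invFun | true => .U | false => .D
  left_inv := by rintro (_ | _) <;> rfl
  right_inv := by rintro (_ | _) <;> rfl

lemma count_true_map (l : List DyckStep) :
    (l.map dyckStepEquivBool).count true = l.count .U :=
  List.count_map_of_injective l _ dyckStepEquivBool.injective .U

lemma count_false_map (l : List DyckStep) :
    (l.map dyckStepEquivBool).count false = l.count .D :=
  List.count_map_of_injective l _ dyckStepEquivBool.injective .D

/-- Mathlib's Dyck words are the lists of Booleans satisfying `IsDyck`. -/
def dyckWordEquiv : DyckWord ≃ {w : List Bool // IsDyck w} where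
  toFun p := ⟨p.toList.map dyckStepEquivBool, by
    simpa [IsDyck, ← List.map_take, count_true_map, count_false_map] using
      ⟨p.count_U_eq_count_D, p.count_D_le_count_U⟩⟩
  invFun w :=
    have hU (l : List Bool) : (l.map dyckStepEquivBool.symm).count .U = l.count true :=
      List.count_map_of_injective l _ dyckStepEquivBool.symm.injective true
    have hD (l : List Bool) : (l.map dyckStepEquivBool.symm).count .D = l.count false :=
      List.count_map_of_injective l _ dyckStepEquivBool.symm.injective false
    ⟨w.1.map dyckStepEquivBool.symm, by rw [hU, hD]; exact w.2.1,
      fun i => by rw [← List.map_take, hU, hD]; exact w.2.2 i⟩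
  left_inv p := by ext1; simp
  right_inv w := by ext1; simp

lemma dyckWordEquiv_ofTree (t : BinaryTree Unit) :
    (dyckWordEquiv (DyckWord.ofTree t)).1 = treeWord t := by
  induction t with
  | nil => rfl
  | node _ l r ihl ihr =>
    rw [treeWord, ← ihl, ← ihr]
    change List.map _ ([DyckStep.U] ++ (DyckWord.ofTree l).toList ++ [DyckStep.D] ++
      (DyckWord.ofTree r).toList) = _
    simp [dyckWordEquiv, dyckStepEquivBool]

lemma count_true_treeWord (t : BinaryTree Unit) : (treeWord t).count true = t.numNodes := by
  induction t with
  | nil => rfl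
  | node _ l r ihl ihr => simp [treeWord, numNodes, ihl, ihr]

open Classical in
/-- The generating function, by number of nodes, of the binary trees satisfying `Q`. -/
noncomputable def treeSeries (Q : BinaryTree Unit → Prop) : PowerSeries ℤ :=
  .mk fun n => (#{t ∈ treesOfNumNodesEq n | Q t} : ℤ)

lemma treeSeries_congr {Q R : BinaryTree Unit → Prop} (h : ∀ t, Q t ↔ R t) :
    treeSeries Q = treeSeries R := by
  rw [funext fun t => propext (h t)]

lemma treeSeries_of_node {Q R S : BinaryTree Unit → Prop} (hnil : Q .nil)
    (hnode : ∀ l r, Q (.node () l r) ↔ R l ∧ S r) :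
    treeSeries Q = 1 + X * treeSeries R * treeSeries S := by
  classical
  ext n
  rw [mul_assoc, map_add]
  cases n with
  | zero => simp [treeSeries, Finset.filter_singleton, hnil]
  | succ n =>
    rw [coeff_succ_X_mul, coeff_mul]
    simp only [treeSeries, coeff_mk, coeff_one, Nat.add_eq_zero_iff, one_ne_zero, and_false,
      if_false, zero_add]
    rw [treesOfNumNodesEq_succ, filter_biUnion, card_biUnion]
    · push_cast
      refine sum_congr rfl fun ij _ => ?_
      rw [← Nat.cast_mul, ← card_product, pairwiseNode, filter_map, card_map,
        ← filter_product]
      congr 2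
      exact filter_congr fun x _ => hnode x.1 x.2
    · intro x _ y _ hxy
      simp only [disjoint_left]
      aesop

lemma treeSeries_ne_nil_and {Q : BinaryTree Unit → Prop} (hnil : Q .nil) :
    treeSeries (fun t => t ≠ .nil ∧ Q t) = treeSeries Q - 1 := by
  classical
  ext n
  rw [map_sub]
  cases n with
  | zero => simp [treeSeries, Finset.filter_singleton, hnil]
  | succ n =>
    simp only [treeSeries, coeff_mk, coeff_one, Nat.add_eq_zero_iff, one_ne_zero, and_false,
      if_false, sub_zero, Nat.cast_inj]
    congr 1
    refine filter_congr fun t ht => ?_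
    have : t ≠ .nil := by
      rintro rfl
      simp at ht
    tauto

lemma treeNoOddPeaksFrom_add_two {h : ℤ} (hh : 1 ≤ h) (t : BinaryTree Unit) :
    TreeNoOddPeaksFrom (h + 2) t ↔ TreeNoOddPeaksFrom h t := by
  induction t generalizing h with
  | nil => rfl
  | node _ l r ihl ihr =>
    have hp : (Odd (h + 2 + 1) ∧ 3 ≤ h + 2 + 1) ↔ (Odd (h + 1) ∧ 3 ≤ h + 1) := by
      simp only [Int.odd_iff]
      omega
    rw [TreeNoOddPeaksFrom, TreeNoOddPeaksFrom, ihr hh, hp, add_right_comm h 2 1,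
      ihl (by omega)]

lemma card_eq_coeff_treeSeries (n : ℕ) :
    (Nat.card {w : List Bool // IsDyck w ∧ w.count true = n ∧
      ∀ i, IsPeakAt w i → ¬ (Odd (ht w (i + 1)) ∧ 3 ≤ ht w (i + 1))} : ℤ) =
    coeff n (treeSeries (TreeNoOddPeaksFrom 0)) := by
  classical
  rw [treeSeries, coeff_mk, ← Nat.card_eq_finsetCard, Nat.cast_inj]
  let e : BinaryTree Unit ≃ {w : List Bool // IsDyck w} :=
    DyckWord.equivTree.symm.trans dyckWordEquiv
  have he (t : BinaryTree Unit) : (e t).1 = treeWord t := dyckWordEquiv_ofTree t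
  refine Nat.card_congr (((e.subtypeEquiv (q := fun w => w.1.count true = n ∧
      ∀ i, IsPeakAt w.1 i → ¬ (Odd (ht w.1 (i + 1)) ∧ 3 ≤ ht w.1 (i + 1))) fun t => ?_).trans
    (Equiv.subtypeSubtypeEquivSubtypeInter IsDyck fun w => w.count true = n ∧
      ∀ i, IsPeakAt w i → ¬ (Odd (ht w (i + 1)) ∧ 3 ≤ ht w (i + 1)))).symm)
  rw [mem_filter, mem_treesOfNumNodesEq, ← noOddPeaksFrom_zero_iff (e t).2, he,
    noOddPeaksFrom_treeWord, count_true_treeWord]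

lemma treeSeries_noOddPeaks_functional_equation :
    treeSeries (TreeNoOddPeaksFrom 0) = 1 + X * treeSeries (TreeNoOddPeaksFrom 0) +
      X ^ 2 * treeSeries (TreeNoOddPeaksFrom 0) ^ 2 := by
  have h₀ : treeSeries (TreeNoOddPeaksFrom 0) =
      1 + X * treeSeries (TreeNoOddPeaksFrom 1) * treeSeries (TreeNoOddPeaksFrom 0) :=
    treeSeries_of_node trivial fun l r => by simp [TreeNoOddPeaksFrom]
  have h₁ : treeSeries (TreeNoOddPeaksFrom 1) =
      1 + X * treeSeries (TreeNoOddPeaksFrom 2) * treeSeries (TreeNoOddPeaksFrom 1) :=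
    treeSeries_of_node trivial fun l r => by
      simp [TreeNoOddPeaksFrom]
  have h₂ : treeSeries (TreeNoOddPeaksFrom 2) =
      1 + X * (treeSeries (TreeNoOddPeaksFrom 1) - 1) * treeSeries (TreeNoOddPeaksFrom 2) := by
    rw [← treeSeries_ne_nil_and (Q := TreeNoOddPeaksFrom 1) trivial]
    refine treeSeries_of_node trivial fun l r => ?_
    have h3 : Odd (3 : ℤ) := by decide
    have := treeNoOddPeaksFrom_add_two le_rfl l
    norm_num at this
    simp [TreeNoOddPeaksFrom, this, h3]
  generalize treeSeries (TreeNoOddPeaksFrom 0) = A at *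
  generalize treeSeries (TreeNoOddPeaksFrom 1) = B at *
  generalize treeSeries (TreeNoOddPeaksFrom 2) = C at *
  have hA : A = C * B := by
    have hunit : A * (1 - X * B) = 1 := by linear_combination h₀
    have hCB : C * B * (1 - X * B) = 1 := by linear_combination B * h₂ + h₁
    linear_combination C * B * hunit - A * hCB
  have hB : B = 1 + X * A := by rw [hA]; linear_combination h₁
  linear_combination h₀ + X * A * hB

/-- If `a n` is the number of Dyck paths of semi-length `n` with no peak of odd
height at least `3`, then its ordinary generating function `f` over `ℤ`
satisfies `f = 1 + x f + x² f²`. -/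
theorem statement1 (a : ℕ → ℕ)
    (ha : ∀ n, a n = Nat.card {w : List Bool // IsDyck w ∧ w.count true = n ∧
      ∀ i, IsPeakAt w i → ¬ (Odd (ht w (i + 1)) ∧ 3 ≤ ht w (i + 1))})
    (f : PowerSeries ℤ) (hf : f = PowerSeries.mk fun n => (a n : ℤ)) :
    f = 1 + PowerSeries.X * f + PowerSeries.X ^ 2 * f ^ 2 := by
  have hf' : f = treeSeries (TreeNoOddPeaksFrom 0) := by
    ext n
    rw [hf, coeff_mk, ha, card_eq_coeff_treeSeries]
  rw [hf']
  exact treeSeries_noOddPeaks_functional_equation
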